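/- arXiv:1307.7572 — 4 statements merged into one kernel-verified Lean document; each statement's English description precedes it below -/
import Mathlib

section
/- The 𝔽-algebra U_q(𝔰𝔩₂) has a presentation by generators A, y, y⁻¹ and relations y y⁻¹ = y⁻¹ y = 1, y²A − (q² + q⁻²)yAy + Ay² = −(a + a⁻¹)(q − q⁻¹)² y, and Ay²A + AyAy + yAyA − [3]_q yA²y + (a + a⁻¹)(q − q⁻¹)²(Ay + yA) = (q² − q⁻²)² y² + (aq − a⁻¹q⁻¹)(aq⁻¹ − a⁻¹q)(q − q⁻¹)², where [3]_q = (q³ − q⁻³)/(q − q⁻¹). Precisely, there is an 𝔽-algebra isomorphism from the algebra with this presentation to U_q(𝔰𝔩₂) sending A ↦ a(1 − qν_x)y⁻¹ + a⁻¹(1 − q⁻¹ν_z)y⁻¹ (which equals a⁻¹x + az) and y^{±1} ↦ y^{±1}, whose inverse sends ν_x ↦ a⁻¹(a + a⁻¹)/(q + q⁻¹) − a⁻¹(qAy − q⁻¹yA)/(q² − q⁻²), y^{±1} ↦ y^{±1}, ν_z ↦ a(a + a⁻¹)/(q + q⁻¹) − a(qyA − q⁻¹Ay)/(q² − q⁻²).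 -/
namespace Paper

/-- Generators for the equitable presentation of `U_q(sl2)`: `x`, `y`, `y⁻¹`, `z`. -/
inductive EqGen : Type
  | x | y | y' | z

/-- The defining relations of the equitable presentation of `U_q(sl2)`. -/
inductive EqRel (F : Type*) [Field F] (q : F) :
    FreeAlgebra F EqGen → FreeAlgebra F EqGen → Prop
  | yy' : EqRel F q (FreeAlgebra.ι F EqGen.y * FreeAlgebra.ι F EqGen.y') 1
  | y'y : EqRel F q (FreeAlgebra.ι F EqGen.y' * FreeAlgebra.ι F EqGen.y) 1
  | xy : EqRel F q
      (q • (FreeAlgebra.ι F EqGen.x * FreeAlgebra.ι F EqGen.y)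
        - q⁻¹ • (FreeAlgebra.ι F EqGen.y * FreeAlgebra.ι F EqGen.x))
      ((q - q⁻¹) • (1 : FreeAlgebra F EqGen))
  | yz : EqRel F q
      (q • (FreeAlgebra.ι F EqGen.y * FreeAlgebra.ι F EqGen.z)
        - q⁻¹ • (FreeAlgebra.ι F EqGen.z * FreeAlgebra.ι F EqGen.y))
      ((q - q⁻¹) • (1 : FreeAlgebra F EqGen))
  | zx : EqRel F q
      (q • (FreeAlgebra.ι F EqGen.z * FreeAlgebra.ι F EqGen.x)
        - q⁻¹ • (FreeAlgebra.ι F EqGen.x * FreeAlgebra.ι F EqGen.z))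
      ((q - q⁻¹) • (1 : FreeAlgebra F EqGen))

/-- `U_q(sl2)` in its equitable presentation. -/
abbrev Usl2 (F : Type*) [Field F] (q : F) := RingQuot (EqRel F q)

noncomputable def ux (F : Type*) [Field F] (q : F) : Usl2 F q :=
  RingQuot.mkAlgHom F (EqRel F q) (FreeAlgebra.ι F EqGen.x)

noncomputable def uy (F : Type*) [Field F] (q : F) : Usl2 F q :=
  RingQuot.mkAlgHom F (EqRel F q) (FreeAlgebra.ι F EqGen.y)

noncomputable def uy' (F : Type*) [Field F] (q : F) : Usl2 F q :=
  RingQuot.mkAlgHom F (EqRel F q) (FreeAlgebra.ι F EqGen.y')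

noncomputable def uz (F : Type*) [Field F] (q : F) : Usl2 F q :=
  RingQuot.mkAlgHom F (EqRel F q) (FreeAlgebra.ι F EqGen.z)

/-- `ν_x = q(1 − yz)`. -/
noncomputable def nux (F : Type*) [Field F] (q : F) : Usl2 F q :=
  q • (1 - uy F q * uz F q)

/-- `ν_z = q(1 − xy)`. -/
noncomputable def nuz (F : Type*) [Field F] (q : F) : Usl2 F q :=
  q • (1 - ux F q * uy F q)

/-- `A = a⁻¹x + az`. -/
noncomputable def uA (F : Type*) [Field F] (q a : F) : Usl2 F q :=
  a⁻¹ • ux F q + a • uz F q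

/-- Generators for the invariant presentation: `A`, `y`, `y⁻¹`. -/
inductive IGen : Type
  | A | y | y'

/-- The defining relations of the invariant presentation:
`y y⁻¹ = y⁻¹ y = 1`,
`y²A − (q² + q⁻²)yAy + Ay² = −(a + a⁻¹)(q − q⁻¹)² y`, and
`Ay²A + AyAy + yAyA − [3]_q yA²y + (a + a⁻¹)(q − q⁻¹)²(Ay + yA)
  = (q² − q⁻²)² y² + (aq − a⁻¹q⁻¹)(aq⁻¹ − a⁻¹q)(q − q⁻¹)²`,
where `[3]_q = (q³ − q⁻³)/(q − q⁻¹)`. -/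
inductive IRel (F : Type*) [Field F] (q a : F) :
    FreeAlgebra F IGen → FreeAlgebra F IGen → Prop
  | yy' : IRel F q a (FreeAlgebra.ι F IGen.y * FreeAlgebra.ι F IGen.y') 1
  | y'y : IRel F q a (FreeAlgebra.ι F IGen.y' * FreeAlgebra.ι F IGen.y) 1
  | tri : IRel F q a
      (FreeAlgebra.ι F IGen.y * FreeAlgebra.ι F IGen.y * FreeAlgebra.ι F IGen.A
        - (q ^ 2 + (q ^ 2)⁻¹) •
            (FreeAlgebra.ι F IGen.y * FreeAlgebra.ι F IGen.A * FreeAlgebra.ι F IGen.y)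
        + FreeAlgebra.ι F IGen.A * FreeAlgebra.ι F IGen.y * FreeAlgebra.ι F IGen.y)
      ((-((a + a⁻¹) * (q - q⁻¹) ^ 2)) • FreeAlgebra.ι F IGen.y)
  | quad : IRel F q a
      (FreeAlgebra.ι F IGen.A * FreeAlgebra.ι F IGen.y * FreeAlgebra.ι F IGen.y *
          FreeAlgebra.ι F IGen.A
        + FreeAlgebra.ι F IGen.A * FreeAlgebra.ι F IGen.y * FreeAlgebra.ι F IGen.A *
            FreeAlgebra.ι F IGen.y
        + FreeAlgebra.ι F IGen.y * FreeAlgebra.ι F IGen.A * FreeAlgebra.ι F IGen.y *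
            FreeAlgebra.ι F IGen.A
        - ((q ^ 3 - (q ^ 3)⁻¹) / (q - q⁻¹)) •
            (FreeAlgebra.ι F IGen.y * FreeAlgebra.ι F IGen.A * FreeAlgebra.ι F IGen.A *
              FreeAlgebra.ι F IGen.y)
        + ((a + a⁻¹) * (q - q⁻¹) ^ 2) •
            (FreeAlgebra.ι F IGen.A * FreeAlgebra.ι F IGen.y
              + FreeAlgebra.ι F IGen.y * FreeAlgebra.ι F IGen.A))
      (((q ^ 2 - (q ^ 2)⁻¹) ^ 2) • (FreeAlgebra.ι F IGen.y * FreeAlgebra.ι F IGen.y)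
        + ((a * q - a⁻¹ * q⁻¹) * (a * q⁻¹ - a⁻¹ * q) * (q - q⁻¹) ^ 2) •
            (1 : FreeAlgebra F IGen))

/-- The algebra with the invariant presentation. -/
abbrev UInv (F : Type*) [Field F] (q a : F) := RingQuot (IRel F q a)

noncomputable def iA (F : Type*) [Field F] (q a : F) : UInv F q a :=
  RingQuot.mkAlgHom F (IRel F q a) (FreeAlgebra.ι F IGen.A)

noncomputable def iy (F : Type*) [Field F] (q a : F) : UInv F q a :=
  RingQuot.mkAlgHom F (IRel F q a) (FreeAlgebra.ι F IGen.y)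

noncomputable def iy' (F : Type*) [Field F] (q a : F) : UInv F q a :=
  RingQuot.mkAlgHom F (IRel F q a) (FreeAlgebra.ι F IGen.y')

section Helpers
variable {F : Type*} [Field F] {R : Type*} [Ring R] [Algebra F R]

theorem q_ne {q : F} (_hq0 : q ≠ 0) (hq4 : q ^ 4 ≠ 1) :
    q ^ 2 - 1 ≠ 0 ∧ q ^ 2 + 1 ≠ 0 := by
  constructor
  · intro h; apply hq4; linear_combination (q ^ 2 + 1) * h
  · intro h; apply hq4; linear_combination (q ^ 2 - 1) * h

theorem fwd_tri {q a : F} (hq0 : q ≠ 0) (ha0 : a ≠ 0) {x y z : R}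
    (hxy : x * y = (q⁻¹ ^ 2) • (y * x) + (1 - q⁻¹ ^ 2) • (1 : R))
    (hzy : z * y = (q ^ 2) • (y * z) + (1 - q ^ 2) • (1 : R)) :
    y * y * (a⁻¹ • x + a • z) - (q ^ 2 + (q ^ 2)⁻¹) • (y * (a⁻¹ • x + a • z) * y)
      + (a⁻¹ • x + a • z) * y * y = (-((a + a⁻¹) * (q - q⁻¹) ^ 2)) • y := by
  have hxy' : ∀ w, x * (y * w) = (q⁻¹ ^ 2) • (y * (x * w)) + (1 - q⁻¹ ^ 2) • w := by
    intro w; rw [← mul_assoc, hxy]; simp [add_mul, mul_assoc]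
  have hzy' : ∀ w, z * (y * w) = (q ^ 2) • (y * (z * w)) + (1 - q ^ 2) • w := by
    intro w; rw [← mul_assoc, hzy]; simp [add_mul, mul_assoc]
  simp only [mul_assoc, mul_add, add_mul, smul_mul_assoc, mul_smul_comm, hxy, hzy, hxy', hzy',
    mul_one, one_mul, smul_add, smul_smul]
  match_scalars <;> field_simp <;> ring

theorem fwd_quad {q a : F} (hq0 : q ≠ 0) (hq4 : q ^ 4 ≠ 1) (ha0 : a ≠ 0) {x y z : R}
    (hxy : x * y = (q⁻¹ ^ 2) • (y * x) + (1 - q⁻¹ ^ 2) • (1 : R))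
    (hzy : z * y = (q ^ 2) • (y * z) + (1 - q ^ 2) • (1 : R))
    (hzx : z * x = (q⁻¹ ^ 2) • (x * z) + (1 - q⁻¹ ^ 2) • (1 : R)) {A : R}
    (hA : A = a⁻¹ • x + a • z) :
    A * y * y * A + A * y * A * y + y * A * y * A
      - ((q ^ 3 - (q ^ 3)⁻¹) / (q - q⁻¹)) • (y * A * A * y)
      + ((a + a⁻¹) * (q - q⁻¹) ^ 2) • (A * y + y * A) =
    ((q ^ 2 - (q ^ 2)⁻¹) ^ 2) • (y * y)
      + ((a * q - a⁻¹ * q⁻¹) * (a * q⁻¹ - a⁻¹ * q) * (q - q⁻¹) ^ 2) • (1 : R) := by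
  obtain ⟨h1, h2⟩ := q_ne hq0 hq4
  have h3 : (q ^ 3 - (q ^ 3)⁻¹) / (q - q⁻¹) = q ^ 2 + 1 + q⁻¹ ^ 2 := by
    have : q - q⁻¹ ≠ 0 := by
      intro h; apply h1; field_simp at h; simpa using h
    rw [div_eq_iff this]; field_simp; ring
  have hxy' : ∀ w, x * (y * w) = (q⁻¹ ^ 2) • (y * (x * w)) + (1 - q⁻¹ ^ 2) • w := by
    intro w; rw [← mul_assoc, hxy]; simp [add_mul, mul_assoc]
  have hzy' : ∀ w, z * (y * w) = (q ^ 2) • (y * (z * w)) + (1 - q ^ 2) • w := by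
    intro w; rw [← mul_assoc, hzy]; simp [add_mul, mul_assoc]
  have hzx' : ∀ w, z * (x * w) = (q⁻¹ ^ 2) • (x * (z * w)) + (1 - q⁻¹ ^ 2) • w := by
    intro w; rw [← mul_assoc, hzx]; simp [add_mul, mul_assoc]
  rw [h3, hA]
  simp only [mul_assoc, mul_add, add_mul, smul_mul_assoc, mul_smul_comm, hxy, hzy, hxy', hzy',
    hzx, hzx', mul_one, one_mul, smul_add, smul_smul]
  match_scalars <;> field_simp <;> ring

def bN (q a : F) (A y : R) : R := (a⁻¹ * (a + a⁻¹) / (q + q⁻¹)) • (1 : R)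
          - (a⁻¹ / (q ^ 2 - (q ^ 2)⁻¹)) • (q • (A * y) - q⁻¹ • (y * A))

def bM (q a : F) (A y : R) : R := (a * (a + a⁻¹) / (q + q⁻¹)) • (1 : R)
          - (a / (q ^ 2 - (q ^ 2)⁻¹)) • (q • (y * A) - q⁻¹ • (A * y))

theorem c_eqs {q a : F} (hq0 : q ≠ 0) (hq4 : q ^ 4 ≠ 1) (ha0 : a ≠ 0) :
    a * (a + a⁻¹) / (q + q⁻¹) = (a ^ 2 + 1) * q * (q ^ 2 + 1)⁻¹ ∧
    a⁻¹ * (a + a⁻¹) / (q + q⁻¹) = (a ^ 2 + 1) * (a ^ 2)⁻¹ * q * (q ^ 2 + 1)⁻¹ ∧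
    a / (q ^ 2 - (q ^ 2)⁻¹) = a * q ^ 2 * (q ^ 2 + 1)⁻¹ * (q ^ 2 - 1)⁻¹ ∧
    a⁻¹ / (q ^ 2 - (q ^ 2)⁻¹) = a⁻¹ * q ^ 2 * (q ^ 2 + 1)⁻¹ * (q ^ 2 - 1)⁻¹ := by
  obtain ⟨h1, h2⟩ := q_ne hq0 hq4
  have e1 : q + q⁻¹ = (q ^ 2 + 1) * q⁻¹ := by field_simp
  have e2 : q ^ 2 - (q ^ 2)⁻¹ = (q ^ 2 + 1) * (q ^ 2 - 1) * (q ^ 2)⁻¹ := by field_simp; ring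
  rw [e1, e2]
  refine ⟨?_, ?_, ?_, ?_⟩ <;> field_simp

variable {q a : F} {A y y' : R}

theorem b_N (hq0 : q ≠ 0) (hq4 : q ^ 4 ≠ 1) (ha0 : a ≠ 0)
    (tri : y * y * A - (q ^ 2 + (q ^ 2)⁻¹) • (y * A * y) + A * y * y
      = (-((a + a⁻¹) * (q - q⁻¹) ^ 2)) • y) :
    bN q a A y * y = q ^ 2 • (y * bN q a A y) := by
  obtain ⟨h1, h2⟩ := q_ne hq0 hq4
  obtain ⟨c1, c2, c3, c4⟩ := c_eqs hq0 hq4 ha0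
  rw [bN, c2, c4]
  simp only [mul_assoc] at tri
  simp only [mul_assoc, mul_sub, sub_mul, smul_mul_assoc, mul_smul_comm, mul_one, one_mul]
  linear_combination (norm := skip) (-(a⁻¹ * q ^ 3 * (q ^ 2 + 1)⁻¹ * (q ^ 2 - 1)⁻¹)) • tri
  match_scalars <;> field_simp <;> ring

theorem b_M (hq0 : q ≠ 0) (hq4 : q ^ 4 ≠ 1) (ha0 : a ≠ 0)
    (tri : y * y * A - (q ^ 2 + (q ^ 2)⁻¹) • (y * A * y) + A * y * y
      = (-((a + a⁻¹) * (q - q⁻¹) ^ 2)) • y) :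
    y * bM q a A y = q ^ 2 • (bM q a A y * y) := by
  obtain ⟨h1, h2⟩ := q_ne hq0 hq4
  obtain ⟨c1, c2, c3, c4⟩ := c_eqs hq0 hq4 ha0
  rw [bM, c1, c3]
  simp only [mul_assoc] at tri
  simp only [mul_assoc, mul_sub, sub_mul, smul_mul_assoc, mul_smul_comm, mul_one, one_mul]
  linear_combination (norm := skip) (-(a * q ^ 3 * (q ^ 2 + 1)⁻¹ * (q ^ 2 - 1)⁻¹)) • tri
  match_scalars <;> field_simp <;> ring

theorem b_quad (hq0 : q ≠ 0) (hq4 : q ^ 4 ≠ 1) (ha0 : a ≠ 0)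
    (quad : A * y * y * A + A * y * A * y + y * A * y * A
      - ((q ^ 3 - (q ^ 3)⁻¹) / (q - q⁻¹)) • (y * A * A * y)
      + ((a + a⁻¹) * (q - q⁻¹) ^ 2) • (A * y + y * A) =
    ((q ^ 2 - (q ^ 2)⁻¹) ^ 2) • (y * y)
      + ((a * q - a⁻¹ * q⁻¹) * (a * q⁻¹ - a⁻¹ * q) * (q - q⁻¹) ^ 2) • (1 : R)) :
    q⁻¹ • (bN q a A y * bM q a A y) - q • (bM q a A y * bN q a A y) + (q - q⁻¹) • (1 : R)
      = (q - q⁻¹) • (y * y) := by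
  obtain ⟨h1, h2⟩ := q_ne hq0 hq4
  obtain ⟨c1, c2, c3, c4⟩ := c_eqs hq0 hq4 ha0
  have h3 : (q ^ 3 - (q ^ 3)⁻¹) / (q - q⁻¹) = q ^ 2 + 1 + q⁻¹ ^ 2 := by
    have : q - q⁻¹ ≠ 0 := by
      intro h; apply h1; field_simp at h; simpa using h
    rw [div_eq_iff this]; field_simp; ring
  rw [h3] at quad
  rw [bN, bM, c1, c2, c3, c4]
  simp only [mul_assoc] at quad
  simp only [mul_assoc, mul_sub, sub_mul, smul_mul_assoc, mul_smul_comm, mul_one, one_mul]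
  linear_combination (norm := skip)
    ((q - q⁻¹) * (q ^ 4 * ((q ^ 2 + 1)⁻¹ * (q ^ 2 - 1)⁻¹) ^ 2)) • quad
  match_scalars <;> field_simp <;> ring

def bZ (q a : F) (A y y' : R) : R := (1 - q • bN q a A y) * y'

def bX (q a : F) (A y y' : R) : R := (1 - q⁻¹ • bM q a A y) * y'

theorem bZy (h : y' * y = 1) : bZ q a A y y' * y = 1 - q • bN q a A y := by
  rw [bZ, mul_assoc, h, mul_one]

theorem bXy (h : y' * y = 1) : bX q a A y y' * y = 1 - q⁻¹ • bM q a A y := by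
  rw [bX, mul_assoc, h, mul_one]

theorem byZ (hq0 : q ≠ 0) (h : y * y' = 1)
    (hN : bN q a A y * y = q ^ 2 • (y * bN q a A y)) :
    y * bZ q a A y y' = 1 - q⁻¹ • bN q a A y := by
  have h1 : y * bN q a A y = (q ^ 2)⁻¹ • (bN q a A y * y) := by
    rw [hN, smul_smul, inv_mul_cancel₀ (pow_ne_zero 2 hq0), one_smul]
  rw [bZ, ← mul_assoc, mul_sub, mul_smul_comm, h1, sub_mul, mul_one, h, smul_mul_assoc,
    smul_mul_assoc, mul_assoc, h, mul_one, smul_smul]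
  congr 2; field_simp

theorem byX (hq0 : q ≠ 0) (h : y * y' = 1)
    (hM : y * bM q a A y = q ^ 2 • (bM q a A y * y)) :
    y * bX q a A y y' = 1 - q • bM q a A y := by
  rw [bX, ← mul_assoc, mul_sub, mul_smul_comm, hM, sub_mul, mul_one, h, smul_mul_assoc,
    smul_mul_assoc, mul_assoc, h, mul_one, smul_smul]
  congr 2; field_simp

theorem b_zx (hq0 : q ≠ 0) (h : y * y' = 1) (h' : y' * y = 1)
    (hN : bN q a A y * y = q ^ 2 • (y * bN q a A y))
    (hM : y * bM q a A y = q ^ 2 • (bM q a A y * y))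
    (hq : q⁻¹ • (bN q a A y * bM q a A y) - q • (bM q a A y * bN q a A y) + (q - q⁻¹) • (1 : R)
      = (q - q⁻¹) • (y * y)) :
    q • (bZ q a A y y' * bX q a A y y') - q⁻¹ • (bX q a A y y' * bZ q a A y y')
      = (q - q⁻¹) • (1 : R) := by
  have can : ∀ w : R, w = y' * (y * w * y) * y' := by
    intro w
    rw [mul_assoc, mul_assoc, h, mul_one, ← mul_assoc, h', one_mul]
  rw [can (_ - _), can (_ • 1)]
  congr 2
  have e1 : y * (bZ q a A y y' * bX q a A y y') * y
      = (1 - q⁻¹ • bN q a A y) * (1 - q⁻¹ • bM q a A y) := by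
    rw [← byZ hq0 h hN, ← bXy (q := q) (a := a) (A := A) h']; simp only [mul_assoc]
  have e2 : y * (bX q a A y y' * bZ q a A y y') * y
      = (1 - q • bM q a A y) * (1 - q • bN q a A y) := by
    rw [← byX hq0 h hM, ← bZy (q := q) (a := a) (A := A) h']; simp only [mul_assoc]
  rw [mul_sub, sub_mul, mul_smul_comm, mul_smul_comm, smul_mul_assoc, smul_mul_assoc, e1, e2,
    mul_smul_comm, smul_mul_assoc, mul_one, ← hq]
  generalize bN q a A y = N
  generalize bM q a A y = M
  simp only [mul_sub, sub_mul, smul_mul_assoc, mul_smul_comm, mul_one, one_mul]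
  match_scalars <;> field_simp <;> ring

theorem b_A (hq0 : q ≠ 0) (hq4 : q ^ 4 ≠ 1) (ha0 : a ≠ 0) (h : y * y' = 1) :
    a⁻¹ • bX q a A y y' + a • bZ q a A y y' = A := by
  have key : a⁻¹ • (1 - q⁻¹ • bM q a A y) + a • (1 - q • bN q a A y) = A * y := by
    obtain ⟨h1, h2⟩ := q_ne hq0 hq4
    obtain ⟨c1, c2, c3, c4⟩ := c_eqs hq0 hq4 ha0
    rw [bN, bM, c1, c2, c3, c4]
    match_scalars <;> field_simp <;> ring
  rw [bX, bZ, ← smul_mul_assoc, ← smul_mul_assoc, ← add_mul, key, mul_assoc, h, mul_one]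

theorem bN_fwd (hq0 : q ≠ 0) (hq4 : q ^ 4 ≠ 1) (ha0 : a ≠ 0) {x z : R}
    (hxy : x * y = (q⁻¹ ^ 2) • (y * x) + (1 - q⁻¹ ^ 2) • (1 : R))
    (hzy : z * y = (q ^ 2) • (y * z) + (1 - q ^ 2) • (1 : R)) :
    bN q a (a⁻¹ • x + a • z) y = q • (1 - y * z) := by
  obtain ⟨h1, h2⟩ := q_ne hq0 hq4
  obtain ⟨c1, c2, c3, c4⟩ := c_eqs hq0 hq4 ha0
  rw [bN, c2, c4]
  simp only [mul_add, add_mul, smul_mul_assoc, mul_smul_comm, hxy, hzy]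
  match_scalars <;> field_simp <;> ring

theorem bM_fwd (hq0 : q ≠ 0) (hq4 : q ^ 4 ≠ 1) (ha0 : a ≠ 0) {x z : R}
    (hxy : x * y = (q⁻¹ ^ 2) • (y * x) + (1 - q⁻¹ ^ 2) • (1 : R))
    (hzy : z * y = (q ^ 2) • (y * z) + (1 - q ^ 2) • (1 : R)) :
    bM q a (a⁻¹ • x + a • z) y = q • (1 - x * y) := by
  obtain ⟨h1, h2⟩ := q_ne hq0 hq4
  obtain ⟨c1, c2, c3, c4⟩ := c_eqs hq0 hq4 ha0
  rw [bM, c1, c3]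
  simp only [mul_add, add_mul, smul_mul_assoc, mul_smul_comm, hxy, hzy]
  match_scalars <;> field_simp <;> ring

theorem bZ_fwd (hq0 : q ≠ 0) (hq4 : q ^ 4 ≠ 1) (ha0 : a ≠ 0) {x z : R} (h : y * y' = 1)
    (hxy : x * y = (q⁻¹ ^ 2) • (y * x) + (1 - q⁻¹ ^ 2) • (1 : R))
    (hzy : z * y = (q ^ 2) • (y * z) + (1 - q ^ 2) • (1 : R)) :
    bZ q a (a⁻¹ • x + a • z) y y' = z := by
  have : 1 - q • (q • (1 - y * z)) = z * y := by
    rw [hzy]; module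
  rw [bZ, bN_fwd hq0 hq4 ha0 hxy hzy, this, mul_assoc, h, mul_one]

theorem bX_fwd (hq0 : q ≠ 0) (hq4 : q ^ 4 ≠ 1) (ha0 : a ≠ 0) {x z : R} (h : y * y' = 1)
    (hxy : x * y = (q⁻¹ ^ 2) • (y * x) + (1 - q⁻¹ ^ 2) • (1 : R))
    (hzy : z * y = (q ^ 2) • (y * z) + (1 - q ^ 2) • (1 : R)) :
    bX q a (a⁻¹ • x + a • z) y y' = x := by
  have : 1 - q⁻¹ • (q • (1 - x * y)) = x * y := by
    rw [smul_smul, inv_mul_cancel₀ hq0, one_smul, sub_sub_cancel]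
  rw [bX, bM_fwd hq0 hq4 ha0 hxy hzy, this, mul_assoc, h, mul_one]

theorem solve1 (hq0 : q ≠ 0) {u v : R} (h : q • (u * v) - q⁻¹ • (v * u) = (q - q⁻¹) • (1 : R)) :
    u * v = (q⁻¹ ^ 2) • (v * u) + (1 - q⁻¹ ^ 2) • (1 : R) := by
  linear_combination (norm := skip) q⁻¹ • h
  match_scalars <;> field_simp <;> ring

theorem solve2 (hq0 : q ≠ 0) {u v : R} (h : q • (u * v) - q⁻¹ • (v * u) = (q - q⁻¹) • (1 : R)) :
    v * u = (q ^ 2) • (u * v) + (1 - q ^ 2) • (1 : R) := by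
  linear_combination (norm := skip) (-q) • h
  match_scalars <;> field_simp <;> ring

end Helpers


theorem u_rels (F : Type*) [Field F] (q : F) :
    uy F q * uy' F q = 1 ∧ uy' F q * uy F q = 1 ∧
    q • (ux F q * uy F q) - q⁻¹ • (uy F q * ux F q) = (q - q⁻¹) • (1 : Usl2 F q) ∧
    q • (uy F q * uz F q) - q⁻¹ • (uz F q * uy F q) = (q - q⁻¹) • (1 : Usl2 F q) ∧
    q • (uz F q * ux F q) - q⁻¹ • (ux F q * uz F q) = (q - q⁻¹) • (1 : Usl2 F q) := by
  have h1 := RingQuot.mkAlgHom_rel F (EqRel.yy' (F := F) (q := q))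
  have h2 := RingQuot.mkAlgHom_rel F (EqRel.y'y (F := F) (q := q))
  have h3 := RingQuot.mkAlgHom_rel F (EqRel.xy (F := F) (q := q))
  have h4 := RingQuot.mkAlgHom_rel F (EqRel.yz (F := F) (q := q))
  have h5 := RingQuot.mkAlgHom_rel F (EqRel.zx (F := F) (q := q))
  simp only [map_mul, map_sub, map_smul, map_one] at h1 h2 h3 h4 h5
  exact ⟨h1, h2, h3, h4, h5⟩

theorem i_rels (F : Type*) [Field F] (q a : F) :
    iy F q a * iy' F q a = 1 ∧ iy' F q a * iy F q a = 1 ∧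
    (iy F q a * iy F q a * iA F q a - (q ^ 2 + (q ^ 2)⁻¹) • (iy F q a * iA F q a * iy F q a)
      + iA F q a * iy F q a * iy F q a = (-((a + a⁻¹) * (q - q⁻¹) ^ 2)) • iy F q a) ∧
    (iA F q a * iy F q a * iy F q a * iA F q a + iA F q a * iy F q a * iA F q a * iy F q a
      + iy F q a * iA F q a * iy F q a * iA F q a
      - ((q ^ 3 - (q ^ 3)⁻¹) / (q - q⁻¹)) • (iy F q a * iA F q a * iA F q a * iy F q a)
      + ((a + a⁻¹) * (q - q⁻¹) ^ 2) • (iA F q a * iy F q a + iy F q a * iA F q a) =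
    ((q ^ 2 - (q ^ 2)⁻¹) ^ 2) • (iy F q a * iy F q a)
      + ((a * q - a⁻¹ * q⁻¹) * (a * q⁻¹ - a⁻¹ * q) * (q - q⁻¹) ^ 2) • (1 : UInv F q a)) := by
  have h1 := RingQuot.mkAlgHom_rel F (IRel.yy' (F := F) (q := q) (a := a))
  have h2 := RingQuot.mkAlgHom_rel F (IRel.y'y (F := F) (q := q) (a := a))
  have h3 := RingQuot.mkAlgHom_rel F (IRel.tri (F := F) (q := q) (a := a))
  have h4 := RingQuot.mkAlgHom_rel F (IRel.quad (F := F) (q := q) (a := a))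
  simp only [map_mul, map_sub, map_add, map_smul, map_one] at h1 h2 h3 h4
  exact ⟨h1, h2, h3, h4⟩

noncomputable def fGen (F : Type*) [Field F] (q a : F) : IGen → Usl2 F q
  | .A => uA F q a
  | .y => uy F q
  | .y' => uy' F q

noncomputable def gGen (F : Type*) [Field F] (q a : F) : EqGen → UInv F q a
  | .x => bX q a (iA F q a) (iy F q a) (iy' F q a)
  | .y => iy F q a
  | .y' => iy' F q a
  | .z => bZ q a (iA F q a) (iy F q a) (iy' F q a)

theorem f_rel (F : Type*) [Field F] (q : F) (hq0 : q ≠ 0) (hq4 : q ^ 4 ≠ 1)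
    (a : F) (ha0 : a ≠ 0) ⦃u v : FreeAlgebra F IGen⦄ (h : IRel F q a u v) :
    FreeAlgebra.lift F (fGen F q a) u = FreeAlgebra.lift F (fGen F q a) v := by
  obtain ⟨h1, h2, h3, h4, h5⟩ := u_rels F q
  cases h
  · simpa [fGen] using h1
  · simpa [fGen] using h2
  · simp only [map_mul, map_sub, map_add, map_smul, FreeAlgebra.lift_ι_apply, fGen]
    exact fwd_tri hq0 ha0 (solve1 hq0 h3) (solve2 hq0 h4)
  · simp only [map_mul, map_sub, map_add, map_smul, map_one, FreeAlgebra.lift_ι_apply, fGen]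
    exact fwd_quad hq0 hq4 ha0 (solve1 hq0 h3) (solve2 hq0 h4) (solve1 hq0 h5) rfl

theorem g_rel (F : Type*) [Field F] (q : F) (hq0 : q ≠ 0) (hq4 : q ^ 4 ≠ 1)
    (a : F) (ha0 : a ≠ 0) ⦃u v : FreeAlgebra F EqGen⦄ (h : EqRel F q u v) :
    FreeAlgebra.lift F (gGen F q a) u = FreeAlgebra.lift F (gGen F q a) v := by
  obtain ⟨h1, h2, h3, h4⟩ := i_rels F q a
  have hN := b_N hq0 hq4 ha0 h3
  have hM := b_M hq0 hq4 ha0 h3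
  cases h
  · simpa [gGen] using h1
  · simpa [gGen] using h2
  · simp only [map_mul, map_sub, map_smul, map_one, FreeAlgebra.lift_ι_apply, gGen]
    rw [bXy h2, byX hq0 h1 hM]
    match_scalars <;> field_simp <;> ring
  · simp only [map_mul, map_sub, map_smul, map_one, FreeAlgebra.lift_ι_apply, gGen]
    rw [bZy h2, byZ hq0 h1 hN]
    match_scalars <;> field_simp <;> ring
  · simp only [map_mul, map_sub, map_smul, map_one, FreeAlgebra.lift_ι_apply, gGen]
    exact b_zx hq0 h1 h2 hN hM (b_quad hq0 hq4 ha0 h4)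

/-- **Theorem 9.1 (invariant presentation).**
The algebra presented by generators `A, y, y⁻¹` and the invariant relations is
isomorphic to `U_q(sl2)`, via the isomorphism sending
`A ↦ a(1 − qν_x)y⁻¹ + a⁻¹(1 − q⁻¹ν_z)y⁻¹` (which equals `a⁻¹x + az`) and
`y^{±1} ↦ y^{±1}`, whose inverse sends
`ν_x ↦ a⁻¹(a + a⁻¹)/(q + q⁻¹) − a⁻¹(qAy − q⁻¹yA)/(q² − q⁻²)`, `y^{±1} ↦ y^{±1}`,
`ν_z ↦ a(a + a⁻¹)/(q + q⁻¹) − a(qyA − q⁻¹Ay)/(q² − q⁻²)`. -/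
theorem statement1 (F : Type*) [Field F] (q : F) (hq0 : q ≠ 0) (hq4 : q ^ 4 ≠ 1)
    (a : F) (ha0 : a ≠ 0) (ha2 : a ^ 2 ≠ 1) :
    ∃ e : UInv F q a ≃ₐ[F] Usl2 F q,
      e (iA F q a) = a • ((1 - q • nux F q) * uy' F q)
          + a⁻¹ • ((1 - q⁻¹ • nuz F q) * uy' F q) ∧
      e (iA F q a) = uA F q a ∧
      e (iy F q a) = uy F q ∧
      e (iy' F q a) = uy' F q ∧
      e.symm (nux F q) = (a⁻¹ * (a + a⁻¹) / (q + q⁻¹)) • (1 : UInv F q a)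
          - (a⁻¹ / (q ^ 2 - (q ^ 2)⁻¹)) •
              (q • (iA F q a * iy F q a) - q⁻¹ • (iy F q a * iA F q a)) ∧
      e.symm (uy F q) = iy F q a ∧
      e.symm (uy' F q) = iy' F q a ∧
      e.symm (nuz F q) = (a * (a + a⁻¹) / (q + q⁻¹)) • (1 : UInv F q a)
          - (a / (q ^ 2 - (q ^ 2)⁻¹)) •
              (q • (iy F q a * iA F q a) - q⁻¹ • (iA F q a * iy F q a)) := by
  obtain ⟨u1, u2, u3, u4, u5⟩ := u_rels F q
  obtain ⟨i1, i2, i3, i4⟩ := i_rels F q a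
  have hxy := solve1 hq0 u3
  have hzy := solve2 hq0 u4
  let f : UInv F q a →ₐ[F] Usl2 F q :=
    RingQuot.liftAlgHom F ⟨FreeAlgebra.lift F (fGen F q a), f_rel F q hq0 hq4 a ha0⟩
  let g : Usl2 F q →ₐ[F] UInv F q a :=
    RingQuot.liftAlgHom F ⟨FreeAlgebra.lift F (gGen F q a), g_rel F q hq0 hq4 a ha0⟩
  have fA : f (iA F q a) = uA F q a := by simp [f, iA, fGen]
  have fy : f (iy F q a) = uy F q := by simp [f, iy, fGen]
  have fy' : f (iy' F q a) = uy' F q := by simp [f, iy', fGen]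
  have gx : g (ux F q) = bX q a (iA F q a) (iy F q a) (iy' F q a) := by simp [g, ux, gGen]
  have gz : g (uz F q) = bZ q a (iA F q a) (iy F q a) (iy' F q a) := by simp [g, uz, gGen]
  have gy : g (uy F q) = iy F q a := by simp [g, uy, gGen]
  have gy' : g (uy' F q) = iy' F q a := by simp [g, uy', gGen]
  have fN : f (bN q a (iA F q a) (iy F q a)) = nux F q := by
    rw [nux, ← bN_fwd hq0 hq4 ha0 hxy hzy]
    simp only [bN, map_sub, map_smul, map_mul, map_one, fA, fy, uA]
  have fM : f (bM q a (iA F q a) (iy F q a)) = nuz F q := by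
    rw [nuz, ← bM_fwd hq0 hq4 ha0 hxy hzy]
    simp only [bM, map_sub, map_smul, map_mul, map_one, fA, fy, uA]
  have fX : f (bX q a (iA F q a) (iy F q a) (iy' F q a)) = ux F q := by
    rw [← bX_fwd hq0 hq4 ha0 u1 hxy hzy]
    simp only [bX, bM, map_sub, map_smul, map_mul, map_one, fA, fy, fy', uA]
  have fZ : f (bZ q a (iA F q a) (iy F q a) (iy' F q a)) = uz F q := by
    rw [← bZ_fwd hq0 hq4 ha0 u1 hxy hzy]
    simp only [bZ, bN, map_sub, map_smul, map_mul, map_one, fA, fy, fy', uA]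
  have fg : f.comp g = AlgHom.id F _ := by
    apply RingQuot.ringQuot_ext'
    apply FreeAlgebra.hom_ext
    funext i
    cases i
    · change f (g (ux F q)) = ux F q
      rw [gx, fX]
    · change f (g (uy F q)) = uy F q
      rw [gy, fy]
    · change f (g (uy' F q)) = uy' F q
      rw [gy', fy']
    · change f (g (uz F q)) = uz F q
      rw [gz, fZ]
  have gf : g.comp f = AlgHom.id F _ := by
    apply RingQuot.ringQuot_ext'
    apply FreeAlgebra.hom_ext
    funext i
    cases i
    · change g (f (iA F q a)) = iA F q a
      rw [fA, uA, map_add, map_smul, map_smul, gx, gz]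
      exact b_A hq0 hq4 ha0 i1
    · change g (f (iy F q a)) = iy F q a
      rw [fy, gy]
    · change g (f (iy' F q a)) = iy' F q a
      rw [fy', gy']
  have gfa : ∀ w, g (f w) = w := fun w => DFunLike.congr_fun gf w
  refine ⟨AlgEquiv.ofAlgHom f g fg gf, ?_, fA, fy, fy', ?_, gy, gy', ?_⟩
  · change f (iA F q a) = _
    have e1 := bX_fwd hq0 hq4 ha0 u1 hxy hzy
    have e2 := bZ_fwd hq0 hq4 ha0 u1 hxy hzy
    rw [bX, bM_fwd hq0 hq4 ha0 hxy hzy] at e1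
    rw [bZ, bN_fwd hq0 hq4 ha0 hxy hzy] at e2
    rw [fA, nux, nuz, e1, e2, uA, add_comm]
  · change g (nux F q) = bN q a (iA F q a) (iy F q a)
    rw [← fN, gfa]
  · change g (nuz F q) = bM q a (iA F q a) (iy F q a)
    rw [← fM, gfa]

end Paper
end

section
/- The 𝔽-algebra U_q^∨ has a presentation by generators X, y⁻¹, Z and relations (q y⁻¹ X − q⁻¹ X y⁻¹)/(q − q⁻¹) = y⁻², (q Z y⁻¹ − q⁻¹ y⁻¹ Z)/(q − q⁻¹) = y⁻², (q Z X − q⁻¹ X Z)/(q − q⁻¹) = 1. Precisely, there is an 𝔽-algebra isomorphism from the abstract algebra on generators X, ȳ, Z subject to these relations onto U_q^∨ sending X ↦ X, ȳ ↦ y⁻¹, Z ↦ Z. -/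
namespace Paper


/-- `X = a⁻²x + (1 − a⁻²)y⁻¹`. -/
noncomputable def uX (F : Type*) [Field F] (q a : F) : Usl2 F q :=
  (a ^ 2)⁻¹ • ux F q + (1 - (a ^ 2)⁻¹) • uy' F q

/-- `Z = a²z + (1 − a²)y⁻¹`. -/
noncomputable def uZ (F : Type*) [Field F] (q a : F) : Usl2 F q :=
  a ^ 2 • uz F q + (1 - a ^ 2) • uy' F q

/-- `U_q^∨`, the subalgebra of `U_q(sl2)` generated by `x`, `y⁻¹`, `z`. -/
noncomputable def Uvee (F : Type*) [Field F] (q : F) : Subalgebra F (Usl2 F q) :=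
  Algebra.adjoin F {ux F q, uy' F q, uz F q}


/-- Generators for the algebra `Ū_q`: `x`, `ȳ`, `z`. -/
inductive BGen : Type
  | x | y | z

/-- The defining relations of `Ū_q`:
`(q ȳ x − q⁻¹ x ȳ)/(q − q⁻¹) = ȳ²`, `(q z ȳ − q⁻¹ ȳ z)/(q − q⁻¹) = ȳ²`,
`(q z x − q⁻¹ x z)/(q − q⁻¹) = 1`. -/
inductive BRel (F : Type*) [Field F] (q : F) :
    FreeAlgebra F BGen → FreeAlgebra F BGen → Prop
  | yx : BRel F q
      (q • (FreeAlgebra.ι F BGen.y * FreeAlgebra.ι F BGen.x)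
        - q⁻¹ • (FreeAlgebra.ι F BGen.x * FreeAlgebra.ι F BGen.y))
      ((q - q⁻¹) • (FreeAlgebra.ι F BGen.y * FreeAlgebra.ι F BGen.y))
  | zy : BRel F q
      (q • (FreeAlgebra.ι F BGen.z * FreeAlgebra.ι F BGen.y)
        - q⁻¹ • (FreeAlgebra.ι F BGen.y * FreeAlgebra.ι F BGen.z))
      ((q - q⁻¹) • (FreeAlgebra.ι F BGen.y * FreeAlgebra.ι F BGen.y))
  | zx : BRel F q
      (q • (FreeAlgebra.ι F BGen.z * FreeAlgebra.ι F BGen.x)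
        - q⁻¹ • (FreeAlgebra.ι F BGen.x * FreeAlgebra.ι F BGen.z))
      ((q - q⁻¹) • (1 : FreeAlgebra F BGen))

/-- The algebra `Ū_q`. -/
abbrev Ubar (F : Type*) [Field F] (q : F) := RingQuot (BRel F q)

noncomputable def bx (F : Type*) [Field F] (q : F) : Ubar F q :=
  RingQuot.mkAlgHom F (BRel F q) (FreeAlgebra.ι F BGen.x)

noncomputable def bybar (F : Type*) [Field F] (q : F) : Ubar F q :=
  RingQuot.mkAlgHom F (BRel F q) (FreeAlgebra.ι F BGen.y)

noncomputable def bz (F : Type*) [Field F] (q : F) : Ubar F q :=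
  RingQuot.mkAlgHom F (BRel F q) (FreeAlgebra.ι F BGen.z)

section helpers
variable {F : Type*} [Field F] {q : F}

lemma b_yx : q • (bybar F q * bx F q) - q⁻¹ • (bx F q * bybar F q)
    = (q - q⁻¹) • (bybar F q * bybar F q) := by
  have := RingQuot.mkAlgHom_rel F (BRel.yx (F := F) (q := q))
  simpa only [bx, bybar, bz, map_sub, map_smul, map_mul] using this

lemma b_zy : q • (bz F q * bybar F q) - q⁻¹ • (bybar F q * bz F q)
    = (q - q⁻¹) • (bybar F q * bybar F q) := by
  have := RingQuot.mkAlgHom_rel F (BRel.zy (F := F) (q := q))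
  simpa only [bx, bybar, bz, map_sub, map_smul, map_mul] using this

lemma b_zx_s3 : q • (bz F q * bx F q) - q⁻¹ • (bx F q * bz F q)
    = (q - q⁻¹) • (1 : Ubar F q) := by
  have := RingQuot.mkAlgHom_rel F (BRel.zx (F := F) (q := q))
  simpa only [bx, bybar, bz, map_sub, map_smul, map_mul, map_one] using this

lemma u_yy' : uy F q * uy' F q = 1 := by
  have := RingQuot.mkAlgHom_rel F (EqRel.yy' (F := F) (q := q))
  simpa only [ux, uy, uy', uz, map_sub, map_smul, map_mul, map_one] using this

lemma u_y'y : uy' F q * uy F q = 1 := by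
  have := RingQuot.mkAlgHom_rel F (EqRel.y'y (F := F) (q := q))
  simpa only [ux, uy, uy', uz, map_sub, map_smul, map_mul, map_one] using this

lemma u_xy : q • (ux F q * uy F q) - q⁻¹ • (uy F q * ux F q)
    = (q - q⁻¹) • (1 : Usl2 F q) := by
  have := RingQuot.mkAlgHom_rel F (EqRel.xy (F := F) (q := q))
  simpa only [ux, uy, uy', uz, map_sub, map_smul, map_mul, map_one] using this

lemma u_yz : q • (uy F q * uz F q) - q⁻¹ • (uz F q * uy F q)
    = (q - q⁻¹) • (1 : Usl2 F q) := by
  have := RingQuot.mkAlgHom_rel F (EqRel.yz (F := F) (q := q))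
  simpa only [ux, uy, uy', uz, map_sub, map_smul, map_mul, map_one] using this

lemma u_zx : q • (uz F q * ux F q) - q⁻¹ • (ux F q * uz F q)
    = (q - q⁻¹) • (1 : Usl2 F q) := by
  have := RingQuot.mkAlgHom_rel F (EqRel.zx (F := F) (q := q))
  simpa only [ux, uy, uy', uz, map_sub, map_smul, map_mul, map_one] using this

lemma u_y'x : q • (uy' F q * ux F q) - q⁻¹ • (ux F q * uy' F q)
    = (q - q⁻¹) • (uy' F q * uy' F q) := by
  have h := congrArg (fun t => uy' F q * t * uy' F q) (u_xy (F := F) (q := q))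
  simp only [mul_sub, sub_mul, mul_smul_comm, smul_mul_assoc, mul_one] at h
  rw [show uy' F q * (ux F q * uy F q) * uy' F q = uy' F q * ux F q * (uy F q * uy' F q) by
      simp only [mul_assoc],
    show uy' F q * (uy F q * ux F q) * uy' F q = (uy' F q * uy F q) * (ux F q * uy' F q) by
      simp only [mul_assoc], u_yy', u_y'y, mul_one, one_mul] at h
  exact h

lemma u_zy' : q • (uz F q * uy' F q) - q⁻¹ • (uy' F q * uz F q)
    = (q - q⁻¹) • (uy' F q * uy' F q) := by
  have h := congrArg (fun t => uy' F q * t * uy' F q) (u_yz (F := F) (q := q))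
  simp only [mul_sub, sub_mul, mul_smul_comm, smul_mul_assoc, mul_one] at h
  rw [show uy' F q * (uz F q * uy F q) * uy' F q = uy' F q * uz F q * (uy F q * uy' F q) by
      simp only [mul_assoc],
    show uy' F q * (uy F q * uz F q) * uy' F q = (uy' F q * uy F q) * (uz F q * uy' F q) by
      simp only [mul_assoc], u_yy', u_y'y, mul_one, one_mul] at h
  exact h

/-- Universal property of `Ubar`. -/
lemma exists_blift {A : Type*} [Ring A] [Algebra F A] (x y z : A)
    (h1 : q • (y * x) - q⁻¹ • (x * y) = (q - q⁻¹) • (y * y))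
    (h2 : q • (z * y) - q⁻¹ • (y * z) = (q - q⁻¹) • (y * y))
    (h3 : q • (z * x) - q⁻¹ • (x * z) = (q - q⁻¹) • (1 : A)) :
    ∃ f : Ubar F q →ₐ[F] A, f (bx F q) = x ∧ f (bybar F q) = y ∧ f (bz F q) = z := by
  let g : BGen → A := fun t => match t with
    | .x => x
    | .y => y
    | .z => z
  refine ⟨RingQuot.liftAlgHom F ⟨FreeAlgebra.lift F g, ?_⟩, ?_, ?_, ?_⟩
  · intro u v h
    cases h <;>
      simpa only [map_sub, map_smul, map_mul, map_one, FreeAlgebra.lift_ι_apply, g]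
  all_goals
    simp [bx, bybar, bz, RingQuot.liftAlgHom_mkAlgHom_apply, g]

/-- Universal property of `Usl2`. -/
lemma exists_ulift {A : Type*} [Ring A] [Algebra F A] (x y y' z : A)
    (h1 : y * y' = 1) (h2 : y' * y = 1)
    (h3 : q • (x * y) - q⁻¹ • (y * x) = (q - q⁻¹) • (1 : A))
    (h4 : q • (y * z) - q⁻¹ • (z * y) = (q - q⁻¹) • (1 : A))
    (h5 : q • (z * x) - q⁻¹ • (x * z) = (q - q⁻¹) • (1 : A)) :
    ∃ f : Usl2 F q →ₐ[F] A, f (ux F q) = x ∧ f (uy' F q) = y' ∧ f (uz F q) = z := by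
  let g : EqGen → A := fun t => match t with
    | .x => x
    | .y => y
    | .y' => y'
    | .z => z
  refine ⟨RingQuot.liftAlgHom F ⟨FreeAlgebra.lift F g, ?_⟩, ?_, ?_, ?_⟩
  · intro u v h
    cases h <;>
      simpa only [map_sub, map_smul, map_mul, map_one, FreeAlgebra.lift_ι_apply, g]
  all_goals
    simp [ux, uy', uz, RingQuot.liftAlgHom_mkAlgHom_apply, g]

lemma b_top : Algebra.adjoin F {bx F q, bybar F q, bz F q} = ⊤ := by
  have h : (RingQuot.mkAlgHom F (BRel F q)).range = ⊤ :=
    (AlgHom.range_eq_top _).2 (RingQuot.mkAlgHom_surjective F _)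
  rw [← h, ← Algebra.map_top, ← FreeAlgebra.adjoin_range_ι, AlgHom.map_adjoin]
  congr 1
  ext t
  constructor
  · rintro (rfl | rfl | rfl)
    exacts [⟨_, ⟨.x, rfl⟩, rfl⟩, ⟨_, ⟨.y, rfl⟩, rfl⟩, ⟨_, ⟨.z, rfl⟩, rfl⟩]
  · rintro ⟨_, ⟨g, rfl⟩, rfl⟩
    cases g
    exacts [Or.inl rfl, Or.inr (Or.inl rfl), Or.inr (Or.inr rfl)]

lemma b_hom_ext {A : Type*} [Ring A] [Algebra F A] {f g : Ubar F q →ₐ[F] A}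
    (h1 : f (bx F q) = g (bx F q)) (h2 : f (bybar F q) = g (bybar F q))
    (h3 : f (bz F q) = g (bz F q)) : f = g := by
  refine AlgHom.ext_of_adjoin_eq_top b_top ?_
  rintro t (rfl | rfl | rfl) <;> assumption

/-- An affine change of generators preserves the relations. -/
lemma affine_rel {A : Type*} [Ring A] [Algebra F A] (x y z : A)
    (h1 : q • (y * x) - q⁻¹ • (x * y) = (q - q⁻¹) • (y * y))
    (h2 : q • (z * y) - q⁻¹ • (y * z) = (q - q⁻¹) • (y * y))
    (h3 : q • (z * x) - q⁻¹ • (x * z) = (q - q⁻¹) • (1 : A)) (s : F) (hs : s ≠ 0) :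
    ∃ f : Ubar F q →ₐ[F] A, f (bx F q) = s⁻¹ • x + (1 - s⁻¹) • y ∧ f (bybar F q) = y ∧
      f (bz F q) = s • z + (1 - s) • y := by
  apply exists_blift
  · simp only [mul_add, add_mul, mul_smul_comm, smul_mul_assoc]
    linear_combination (norm := module) s⁻¹ • h1
  · simp only [mul_add, add_mul, mul_smul_comm, smul_mul_assoc]
    linear_combination (norm := module) s • h2
  · have e : q • ((s • z + (1 - s) • y) * (s⁻¹ • x + (1 - s⁻¹) • y))
        - q⁻¹ • ((s⁻¹ • x + (1 - s⁻¹) • y) * (s • z + (1 - s) • y))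
      = (s * s⁻¹) • (q • (z * x) - q⁻¹ • (x * z))
        + ((1 - s) * s⁻¹) • (q • (y * x) - q⁻¹ • (x * y))
        + (s * (1 - s⁻¹)) • (q • (z * y) - q⁻¹ • (y * z))
        + ((1 - s) * (1 - s⁻¹) * (q - q⁻¹)) • (y * y) := by
      simp only [mul_add, add_mul, mul_smul_comm, smul_mul_assoc]
      module
    rw [e, h1, h2, h3, mul_inv_cancel₀ hs]
    match_scalars
    · ring
    · field_simp
      ring

/-! Spanning set of `Ubar`. -/

/-- The monomials `y^m x^i z^k`. -/
noncomputable def bmon (F : Type*) [Field F] (q : F) (t : ℕ × ℕ × ℕ) : Ubar F q :=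
  bybar F q ^ t.1 * bx F q ^ t.2.1 * bz F q ^ t.2.2

lemma b_xy' (hq0 : q ≠ 0) : bx F q * bybar F q
    = q ^ 2 • (bybar F q * bx F q) + (1 - q ^ 2) • (bybar F q * bybar F q) := by
  have h := congrArg (fun t => q • t) (b_yx (F := F) (q := q))
  simp only [smul_sub, smul_smul, mul_inv_cancel₀ hq0, one_smul, mul_sub] at h
  simp only [sub_smul, pow_two, mul_inv] at h ⊢
  linear_combination (norm := module) -h

lemma b_zy2 (hq0 : q ≠ 0) : bz F q * bybar F q
    = (q ^ 2)⁻¹ • (bybar F q * bz F q) + (1 - (q ^ 2)⁻¹) • (bybar F q * bybar F q) := by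
  have h := congrArg (fun t => q⁻¹ • t) (b_zy (F := F) (q := q))
  simp only [smul_sub, smul_smul, inv_mul_cancel₀ hq0, one_smul, mul_sub] at h
  simp only [sub_smul, pow_two, mul_inv] at h ⊢
  linear_combination (norm := module) h

lemma b_zx2 (hq0 : q ≠ 0) : bz F q * bx F q
    = (q ^ 2)⁻¹ • (bx F q * bz F q) + (1 - (q ^ 2)⁻¹) • (1 : Ubar F q) := by
  have h := congrArg (fun t => q⁻¹ • t) (b_zx_s3 (F := F) (q := q))
  simp only [smul_sub, smul_smul, inv_mul_cancel₀ hq0, one_smul, mul_sub] at h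
  simp only [sub_smul, pow_two, mul_inv] at h ⊢
  linear_combination (norm := module) h

/-- Commuting a generator past powers of `y`. -/
lemma pow_comm_y {A : Type*} [Ring A] [Algebra F A] (x y : A) (c : F)
    (h : x * y = c • (y * x) + (1 - c) • (y * y)) (m : ℕ) :
    x * y ^ m = c ^ m • (y ^ m * x) + (1 - c ^ m) • y ^ (m + 1) := by
  induction m with
  | zero => simp
  | succ m ih =>
    rw [pow_succ, ← mul_assoc, ih, add_mul, smul_mul_assoc, mul_assoc, h]
    simp only [mul_add, mul_smul_comm, smul_mul_assoc, ← mul_assoc, ← pow_succ]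
    module

lemma pow_comm_x {A : Type*} [Ring A] [Algebra F A] (z x : A) (c : F)
    (h : z * x = c • (x * z) + (1 - c) • (1 : A)) (m : ℕ) :
    z * x ^ m = c ^ m • (x ^ m * z) + (1 - c ^ m) • x ^ (m - 1) := by
  induction m with
  | zero => simp
  | succ m ih =>
    rw [pow_succ, ← mul_assoc, ih, add_mul, smul_mul_assoc, mul_assoc, h]
    rcases m with _ | m
    · simp
    · simp only [mul_add, mul_smul_comm, smul_mul_assoc, ← mul_assoc, ← pow_succ,
        Nat.add_sub_cancel, mul_one]
      module

lemma bmon_span (hq0 : q ≠ 0) : Submodule.span F (Set.range (bmon F q)) = ⊤ := by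
  set S := Submodule.span F (Set.range (bmon F q)) with hS
  have mem : ∀ m i k : ℕ, bybar F q ^ m * bx F q ^ i * bz F q ^ k ∈ S := fun m i k =>
    Submodule.subset_span ⟨(m, i, k), rfl⟩
  have key : ∀ g : Ubar F q, (∀ t, g * bmon F q t ∈ S) → ∀ s ∈ S, g * s ∈ S := by
    intro g hg s hs
    induction hs using Submodule.span_induction with
    | mem x h => obtain ⟨t, rfl⟩ := h; exact hg t
    | zero => simp
    | add x y _ _ hx hy => rw [mul_add]; exact S.add_mem hx hy
    | smul c x _ hx => rw [mul_smul_comm]; exact S.smul_mem c hx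
  have all : ∀ b : Ubar F q, ∀ s ∈ S, b * s ∈ S := by
    intro b
    have hb : b ∈ Algebra.adjoin F {bx F q, bybar F q, bz F q} := by
      rw [b_top]; trivial
    induction hb using Algebra.adjoin_induction with
    | mem x h =>
      apply key
      rintro ⟨m, i, k⟩
      rcases h with rfl | rfl | rfl
      · have : bx F q * bmon F q (m, i, k) = (q ^ 2) ^ m • bmon F q (m, i + 1, k)
            + (1 - (q ^ 2) ^ m) • bmon F q (m + 1, i, k) := by
          simp only [bmon]
          rw [← mul_assoc, ← mul_assoc, pow_comm_y _ _ _ (b_xy' hq0)]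
          simp only [add_mul, smul_mul_assoc, mul_assoc, pow_succ' (bx F q)]
        rw [this]
        exact S.add_mem (S.smul_mem _ (mem _ _ _)) (S.smul_mem _ (mem _ _ _))
      · have : bybar F q * bmon F q (m, i, k) = bmon F q (m + 1, i, k) := by
          simp only [bmon, pow_succ' (bybar F q), mul_assoc]
        rw [this]
        exact mem _ _ _
      · have : bz F q * bmon F q (m, i, k) =
            ((q ^ 2)⁻¹) ^ m • (((q ^ 2)⁻¹) ^ i • bmon F q (m, i, k + 1)
              + (1 - ((q ^ 2)⁻¹) ^ i) • bmon F q (m, i - 1, k))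
            + (1 - ((q ^ 2)⁻¹) ^ m) • bmon F q (m + 1, i, k) := by
          simp only [bmon]
          rw [← mul_assoc, ← mul_assoc, pow_comm_y _ _ _ (b_zy2 hq0), add_mul, smul_mul_assoc,
            mul_assoc, pow_comm_x _ _ _ (b_zx2 hq0)]
          simp only [add_mul, mul_add, smul_mul_assoc, mul_smul_comm, mul_assoc,
            pow_succ' (bz F q)]
        rw [this]
        exact S.add_mem (S.smul_mem _ (S.add_mem (S.smul_mem _ (mem _ _ _))
          (S.smul_mem _ (mem _ _ _)))) (S.smul_mem _ (mem _ _ _))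
    | algebraMap r =>
      intro s hs
      rw [← Algebra.smul_def]; exact S.smul_mem r hs
    | add x y _ _ hx hy =>
      intro s hs; rw [add_mul]; exact S.add_mem (hx s hs) (hy s hs)
    | mul x y _ _ hx hy =>
      intro s hs; rw [mul_assoc]; exact hx _ (hy s hs)
  rw [eq_top_iff]
  intro b _
  have := all b 1 (by simpa using mem 0 0 0)
  simpa using this

/-! The regular representation of `Usl2` on the basis `y^j x^i z^k`. -/

/-- The underlying space. -/
abbrev Mod (F : Type*) [Field F] := (ℤ × ℕ × ℕ) →₀ F

/-- basis vector -/
noncomputable def ev (F : Type*) [Field F] (j : ℤ) (i k : ℕ) : Mod F :=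
  Finsupp.single (j, i, k) 1

/-- operator given by values on the basis -/
noncomputable def op (g : ℤ → ℕ → ℕ → Mod F) : Module.End F (Mod F) :=
  Finsupp.linearCombination F (fun t : ℤ × ℕ × ℕ => g t.1 t.2.1 t.2.2)

@[simp] lemma op_ev (g : ℤ → ℕ → ℕ → Mod F) (j : ℤ) (i k : ℕ) :
    op g (ev F j i k) = g j i k := by
  simp [op, ev]

lemma end_ext {f g : Module.End F (Mod F)} (h : ∀ j i k, f (ev F j i k) = g (ev F j i k)) :
    f = g := by
  apply Finsupp.lhom_ext'
  rintro ⟨j, i, k⟩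
  apply LinearMap.ext_ring
  exact h j i k

noncomputable def oy (F : Type*) [Field F] : Module.End F (Mod F) :=
  op fun j i k => ev F (j + 1) i k
noncomputable def oy' (F : Type*) [Field F] : Module.End F (Mod F) :=
  op fun j i k => ev F (j - 1) i k
noncomputable def ox (F : Type*) [Field F] (q : F) : Module.End F (Mod F) :=
  op fun j i k => (q ^ (2 * j))⁻¹ • ev F j (i + 1) k + (1 - (q ^ (2 * j))⁻¹) • ev F (j - 1) i k
noncomputable def oz (F : Type*) [Field F] (q : F) : Module.End F (Mod F) :=
  op fun j i k => q ^ (2 * j) • ((q ^ (2 * i))⁻¹ • ev F j i (k + 1)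
    + (1 - (q ^ (2 * i))⁻¹) • ev F j (i - 1) k) + (1 - q ^ (2 * j)) • ev F (j - 1) i k

lemma exists_rep (hq0 : q ≠ 0) : ∃ f : Usl2 F q →ₐ[F] Module.End F (Mod F),
    f (ux F q) = ox F q ∧ f (uy' F q) = oy' F ∧ f (uz F q) = oz F q := by
  have hz : ∀ j : ℤ, q ^ (2 * (j + 1)) = q ^ (2 * j) * q ^ 2 := by
    intro j
    rw [mul_add, zpow_add₀ hq0]; norm_cast
  have hz' : ∀ j : ℤ, q ^ (2 * (j - 1)) = q ^ (2 * j) * (q ^ 2)⁻¹ := by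
    intro j
    rw [mul_sub, zpow_sub₀ hq0, div_eq_mul_inv]; norm_cast
  have hp : ∀ j : ℤ, q ^ (2 * j) ≠ 0 := fun j => zpow_ne_zero _ hq0
  apply exists_ulift (ox F q) (oy F) (oy' F) (oz F q)
  · apply end_ext; intro j i k; simp [oy, oy']
  · apply end_ext; intro j i k; simp [oy, oy']
  · apply end_ext; intro j i k
    have := hp j
    simp [oy, ox, hz]
    generalize q ^ (2 * j) = t at *
    match_scalars <;> field_simp <;> ring
  · apply end_ext; intro j i k
    have := hp j
    simp [oy, oz, hz]
    generalize q ^ (2 * j) = t at *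
    match_scalars <;> field_simp <;> ring
  · apply end_ext; intro j i k
    have := hp j
    rcases i with _ | i
    · simp [ox, oz, hz, hz']
      generalize q ^ (2 * j) = t at *
      match_scalars <;> field_simp <;> ring
    · simp [ox, oz, hz, hz']
      generalize q ^ (2 * j) = t at *
      match_scalars <;> field_simp <;> ring

lemma rep_mon (m i k : ℕ) :
    (oy' F ^ m * ox F q ^ i * oz F q ^ k) (ev F 0 0 0) = ev F (-(m : ℤ)) i k := by
  have h1 : ∀ k : ℕ, (oz F q ^ k) (ev F 0 0 0) = ev F 0 0 k := by
    intro k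
    induction k with
    | zero => simp
    | succ k ih => rw [pow_succ', Module.End.mul_apply, ih]; simp [oz]
  have h2 : ∀ i k : ℕ, (ox F q ^ i) (ev F 0 0 k) = ev F 0 i k := by
    intro i k
    induction i with
    | zero => simp
    | succ k ih => rw [pow_succ', Module.End.mul_apply, ih]; simp [ox]
  have h3 : ∀ m : ℕ, (oy' F ^ m) (ev F 0 i k) = ev F (-(m : ℤ)) i k := by
    intro m
    induction m with
    | zero => simp
    | succ k ih =>
      rw [pow_succ', Module.End.mul_apply, ih]; simp [oy']; congr 1; ring
  rw [Module.End.mul_apply, Module.End.mul_apply, h1, h2, h3]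

lemma e0_injective (hq0 : q ≠ 0) (f : Ubar F q →ₐ[F] Usl2 F q) (hx : f (bx F q) = ux F q)
    (hy : f (bybar F q) = uy' F q) (hz : f (bz F q) = uz F q) : Function.Injective f := by
  obtain ⟨r, rx, ry, rz⟩ := exists_rep (F := F) hq0
  rw [injective_iff_map_eq_zero]
  intro b hb
  have hs : b ∈ Submodule.span F (Set.range (bmon F q)) := by
    rw [bmon_span hq0]; trivial
  rw [Finsupp.mem_span_range_iff_exists_finsupp] at hs
  obtain ⟨c, rfl⟩ := hs
  have h0 : r (f (c.sum fun i a => a • bmon F q i)) (ev F 0 0 0) = 0 := by rw [hb]; simp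
  have hc : c.mapDomain (fun t : ℕ × ℕ × ℕ => ((-(t.1 : ℤ), t.2.1, t.2.2) : ℤ × ℕ × ℕ)) = 0 := by
    rw [← h0, Finsupp.mapDomain, Finsupp.sum, Finsupp.sum, map_sum, map_sum, LinearMap.sum_apply]
    refine Finset.sum_congr rfl ?_
    rintro ⟨m, i, k⟩ _
    rw [map_smul, map_smul, LinearMap.smul_apply]
    simp only [bmon, map_mul, map_pow, hx, hy, hz, rx, ry, rz, rep_mon]
    simp [ev]
  have : c = 0 := by
    refine Finsupp.mapDomain_injective ?_ (hc.trans Finsupp.mapDomain_zero.symm)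
    rintro ⟨m, i, k⟩ ⟨m', i', k'⟩ h
    simpa using h
  rw [this]; simp

end helpers

/-- **Theorem 10.20.** `U_q^∨` has a presentation by generators `X, y⁻¹, Z` and relations
`(q y⁻¹ X − q⁻¹ X y⁻¹)/(q − q⁻¹) = y⁻²`, `(q Z y⁻¹ − q⁻¹ y⁻¹ Z)/(q − q⁻¹) = y⁻²`,
`(q Z X − q⁻¹ X Z)/(q − q⁻¹) = 1`: the algebra homomorphism from the abstract algebra
on generators `X, ȳ, Z` subject to these relations into `U_q(sl2)`, sending
`X ↦ X`, `ȳ ↦ y⁻¹`, `Z ↦ Z`, is an isomorphism onto `U_q^∨`. -/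
theorem statement3 (F : Type*) [Field F] (q : F) (hq0 : q ≠ 0) (hq4 : q ^ 4 ≠ 1)
    (a : F) (ha0 : a ≠ 0) (ha2 : a ^ 2 ≠ 1) :
    ∃ e : Ubar F q →ₐ[F] Usl2 F q,
      e (bx F q) = uX F q a ∧
      e (bybar F q) = uy' F q ∧
      e (bz F q) = uZ F q a ∧
      Function.Injective e ∧
      e.range = Uvee F q := by
  obtain ⟨f, fx, fy, fz⟩ := exists_blift (ux F q) (uy' F q) (uz F q) u_y'x u_zy' u_zx
  have hs : a ^ 2 ≠ 0 := pow_ne_zero _ ha0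
  obtain ⟨p, px, py, pz⟩ := affine_rel (bx F q) (bybar F q) (bz F q) b_yx b_zy b_zx_s3 _ hs
  obtain ⟨p', px', py', pz'⟩ :=
    affine_rel (bx F q) (bybar F q) (bz F q) b_yx b_zy b_zx_s3 _ (inv_ne_zero hs)
  have h1 : p'.comp p = AlgHom.id F _ := by
    apply b_hom_ext
    · simp only [AlgHom.comp_apply, px, map_add, map_smul, px', py', AlgHom.id_apply]
      match_scalars <;> field_simp <;> ring
    · simp [py, py']
    · simp only [AlgHom.comp_apply, pz, map_add, map_smul, pz', py', AlgHom.id_apply]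
      match_scalars <;> field_simp <;> ring
  have h2 : p.comp p' = AlgHom.id F _ := by
    apply b_hom_ext
    · simp only [AlgHom.comp_apply, px, map_add, map_smul, px', py, AlgHom.id_apply]
      match_scalars <;> field_simp <;> ring
    · simp [py, py']
    · simp only [AlgHom.comp_apply, pz, map_add, map_smul, pz', py, AlgHom.id_apply]
      match_scalars <;> field_simp <;> ring
  have pinj : Function.Injective p :=
    Function.LeftInverse.injective (g := p') fun t => DFunLike.congr_fun h1 t
  have psurj : Function.Surjective p :=
    Function.RightInverse.surjective (g := p') fun t => DFunLike.congr_fun h2 t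
  refine ⟨f.comp p, ?_, ?_, ?_, ?_, ?_⟩
  · simp only [AlgHom.comp_apply, px, map_add, map_smul, fx, fy, uX]
  · simp only [AlgHom.comp_apply, py, fy]
  · simp only [AlgHom.comp_apply, pz, map_add, map_smul, fz, fy, uZ]
  · exact (e0_injective hq0 f fx fy fz).comp pinj
  · rw [AlgHom.range_comp, (AlgHom.range_eq_top p).2 psurj, ← b_top, AlgHom.map_adjoin, Uvee]
    congr 1
    simp only [Set.image_insert_eq, Set.image_singleton, fx, fy, fz]

end Paper
end

section
/- The 𝔽-algebra U_q^∨ has a presentation by generators x, X, A and relations (qAx − q⁻¹xA)/(q − q⁻¹) = a⁻¹x² + a, (qAX − q⁻¹XA)/(q − q⁻¹) = aX² + a⁻¹, and a⁻¹x² − ((a⁻¹q − aq⁻¹)/(q − q⁻¹))xX − ((aq − a⁻¹q⁻¹)/(q − q⁻¹))Xx + aX² = 0. Precisely, there is an 𝔽-algebra isomorphism from the algebra with this presentation to U_q^∨ (presented by generators x, y⁻¹, z with relations (q y⁻¹ x − q⁻¹ x y⁻¹)/(q − q⁻¹) = y⁻², (q z y⁻¹ − q⁻¹ y⁻¹ z)/(q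 − q⁻¹) = y⁻², (q z x − q⁻¹ x z)/(q − q⁻¹) = 1) sending x ↦ x, X ↦ a⁻²x + (1 − a⁻²)y⁻¹, A ↦ a⁻¹x + az, whose inverse sends x ↦ x, y⁻¹ ↦ (aX − a⁻¹x)/(a − a⁻¹), z ↦ a⁻¹A − a⁻²x. -/
namespace Paper

/-- Generators `x`, `X`, `A`. -/
inductive PGen : Type
  | x | X | A

/-- The defining relations among `x`, `X`, `A`:
`(qAx − q⁻¹xA)/(q − q⁻¹) = a⁻¹x² + a`, `(qAX − q⁻¹XA)/(q − q⁻¹) = aX² + a⁻¹`,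
`a⁻¹x² − ((a⁻¹q − aq⁻¹)/(q − q⁻¹))xX − ((aq − a⁻¹q⁻¹)/(q − q⁻¹))Xx + aX² = 0`. -/
inductive PRel (F : Type*) [Field F] (q a : F) :
    FreeAlgebra F PGen → FreeAlgebra F PGen → Prop
  | Ax : PRel F q a
      (q • (FreeAlgebra.ι F PGen.A * FreeAlgebra.ι F PGen.x)
        - q⁻¹ • (FreeAlgebra.ι F PGen.x * FreeAlgebra.ι F PGen.A))
      ((q - q⁻¹) • (a⁻¹ • (FreeAlgebra.ι F PGen.x * FreeAlgebra.ι F PGen.x)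
        + a • (1 : FreeAlgebra F PGen)))
  | AX : PRel F q a
      (q • (FreeAlgebra.ι F PGen.A * FreeAlgebra.ι F PGen.X)
        - q⁻¹ • (FreeAlgebra.ι F PGen.X * FreeAlgebra.ι F PGen.A))
      ((q - q⁻¹) • (a • (FreeAlgebra.ι F PGen.X * FreeAlgebra.ι F PGen.X)
        + a⁻¹ • (1 : FreeAlgebra F PGen)))
  | xX : PRel F q a
      (a⁻¹ • (FreeAlgebra.ι F PGen.x * FreeAlgebra.ι F PGen.x)
        - ((a⁻¹ * q - a * q⁻¹) / (q - q⁻¹)) •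
            (FreeAlgebra.ι F PGen.x * FreeAlgebra.ι F PGen.X)
        - ((a * q - a⁻¹ * q⁻¹) / (q - q⁻¹)) •
            (FreeAlgebra.ι F PGen.X * FreeAlgebra.ι F PGen.x)
        + a • (FreeAlgebra.ι F PGen.X * FreeAlgebra.ι F PGen.X))
      0

/-- The algebra presented by generators `x, X, A` and the above relations. -/
abbrev UP (F : Type*) [Field F] (q a : F) := RingQuot (PRel F q a)

noncomputable def px (F : Type*) [Field F] (q a : F) : UP F q a :=
  RingQuot.mkAlgHom F (PRel F q a) (FreeAlgebra.ι F PGen.x)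

noncomputable def pX (F : Type*) [Field F] (q a : F) : UP F q a :=
  RingQuot.mkAlgHom F (PRel F q a) (FreeAlgebra.ι F PGen.X)

noncomputable def pA (F : Type*) [Field F] (q a : F) : UP F q a :=
  RingQuot.mkAlgHom F (PRel F q a) (FreeAlgebra.ι F PGen.A)

theorem brel_yx (F : Type*) [Field F] (q : F) :
    q • (bybar F q * bx F q) - q⁻¹ • (bx F q * bybar F q)
      = (q - q⁻¹) • (bybar F q * bybar F q) := by
  simpa [bx, bybar, bz] using RingQuot.mkAlgHom_rel F (BRel.yx (F := F) (q := q))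

theorem brel_zy (F : Type*) [Field F] (q : F) :
    q • (bz F q * bybar F q) - q⁻¹ • (bybar F q * bz F q)
      = (q - q⁻¹) • (bybar F q * bybar F q) := by
  simpa [bx, bybar, bz] using RingQuot.mkAlgHom_rel F (BRel.zy (F := F) (q := q))

theorem brel_zx (F : Type*) [Field F] (q : F) :
    q • (bz F q * bx F q) - q⁻¹ • (bx F q * bz F q) = (q - q⁻¹) • (1 : Ubar F q) := by
  simpa only [bx, bybar, bz, map_sub, map_smul, map_mul, map_one] using
    RingQuot.mkAlgHom_rel F (BRel.zx (F := F) (q := q))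

theorem prel_Ax (F : Type*) [Field F] (q a : F) :
    q • (pA F q a * px F q a) - q⁻¹ • (px F q a * pA F q a)
      = (q - q⁻¹) • (a⁻¹ • (px F q a * px F q a) + a • (1 : UP F q a)) := by
  simpa only [px, pX, pA, map_sub, map_add, map_smul, map_mul, map_one] using
    RingQuot.mkAlgHom_rel F (PRel.Ax (F := F) (q := q) (a := a))

theorem prel_AX (F : Type*) [Field F] (q a : F) :
    q • (pA F q a * pX F q a) - q⁻¹ • (pX F q a * pA F q a)
      = (q - q⁻¹) • (a • (pX F q a * pX F q a) + a⁻¹ • (1 : UP F q a)) := by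
  simpa only [px, pX, pA, map_sub, map_add, map_smul, map_mul, map_one] using
    RingQuot.mkAlgHom_rel F (PRel.AX (F := F) (q := q) (a := a))

theorem prel_xX (F : Type*) [Field F] (q a : F) :
    a⁻¹ • (px F q a * px F q a)
      - ((a⁻¹ * q - a * q⁻¹) / (q - q⁻¹)) • (px F q a * pX F q a)
      - ((a * q - a⁻¹ * q⁻¹) / (q - q⁻¹)) • (pX F q a * px F q a)
      + a • (pX F q a * pX F q a) = 0 := by
  simpa only [px, pX, pA, map_sub, map_add, map_smul, map_mul, map_one, map_zero] using
    RingQuot.mkAlgHom_rel F (PRel.xX (F := F) (q := q) (a := a))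

/-- images of the generators `x, X, A` -/
noncomputable def fwdGen (F : Type*) [Field F] (q a : F) : PGen → Ubar F q
  | PGen.x => bx F q
  | PGen.X => (a ^ 2)⁻¹ • bx F q + (1 - (a ^ 2)⁻¹) • bybar F q
  | PGen.A => a⁻¹ • bx F q + a • bz F q

/-- images of the generators `x, y, z` -/
noncomputable def bwdGen (F : Type*) [Field F] (q a : F) : BGen → UP F q a
  | BGen.x => px F q a
  | BGen.y => (a - a⁻¹)⁻¹ • (a • pX F q a - a⁻¹ • px F q a)
  | BGen.z => a⁻¹ • pA F q a - (a ^ 2)⁻¹ • px F q a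

theorem fwd_rel (F : Type*) [Field F] (q : F) (hq0 : q ≠ 0) (hq2 : q ^ 2 - 1 ≠ 0)
    (a : F) (ha0 : a ≠ 0) {r s : FreeAlgebra F PGen} (h : PRel F q a r s) :
    FreeAlgebra.lift F (fwdGen F q a) r = FreeAlgebra.lift F (fwdGen F q a) s := by
  have hqq : q - q⁻¹ = (q ^ 2 - 1) / q := by field_simp
  have h1 := brel_yx F q
  have h2 := brel_zy F q
  have h3 := brel_zx F q
  rw [hqq] at h1 h2 h3
  cases h <;>
  simp only [map_sub, map_add, map_smul, map_mul, map_one, map_zero, FreeAlgebra.lift_ι_apply,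
    fwdGen, mul_add, add_mul, mul_sub, sub_mul, smul_mul_assoc, mul_smul_comm, hqq]
  · linear_combination (norm := skip) a • h3
    match_scalars <;> field_simp <;> ring
  · linear_combination (norm := skip) a⁻¹ • h3 + (a * (1 - (a ^ 2)⁻¹)) • h2
      - (a⁻¹ * (1 - (a ^ 2)⁻¹)) • h1
    match_scalars <;> field_simp <;> ring
  · linear_combination (norm := skip)
      (-((a - a⁻¹) ^ 2 * a⁻¹ * (q / (q ^ 2 - 1)))) • h1
    match_scalars <;> field_simp <;> ring

theorem bwd_rel (F : Type*) [Field F] (q : F) (hq0 : q ≠ 0) (hq2 : q ^ 2 - 1 ≠ 0)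
    (a : F) (ha0 : a ≠ 0) (ha2 : a ^ 2 - 1 ≠ 0) {r s : FreeAlgebra F BGen} (h : BRel F q r s) :
    FreeAlgebra.lift F (bwdGen F q a) r = FreeAlgebra.lift F (bwdGen F q a) s := by
  have hqq : q - q⁻¹ = (q ^ 2 - 1) / q := by field_simp
  have haa : a - a⁻¹ = (a ^ 2 - 1) / a := by field_simp
  have h1 := prel_Ax F q a
  have h2 := prel_AX F q a
  have h3 := prel_xX F q a
  rw [hqq] at h1 h2 h3
  cases h <;>
  simp only [map_sub, map_add, map_smul, map_mul, map_one, map_zero, FreeAlgebra.lift_ι_apply,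
    bwdGen, mul_add, add_mul, mul_sub, sub_mul, smul_mul_assoc, mul_smul_comm, hqq, haa]
  · linear_combination (norm := skip)
      (-(a * ((q ^ 2 - 1) / q) * (a / (a ^ 2 - 1)) ^ 2)) • h3
    match_scalars <;> field_simp <;> ring
  · linear_combination (norm := skip)
      (a / (a ^ 2 - 1)) • h2 - (a⁻¹ / (a ^ 2 - 1)) • h1
      + (-(a⁻¹ * ((q ^ 2 - 1) / q) * (a / (a ^ 2 - 1)) ^ 2)) • h3
    match_scalars <;> field_simp <;> ring
  · linear_combination (norm := skip) a⁻¹ • h1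
    match_scalars <;> field_simp <;> ring

/-- **Theorem 10.21.** `U_q^∨` has a presentation by generators `x, X, A` and relations
`(qAx − q⁻¹xA)/(q − q⁻¹) = a⁻¹x² + a`, `(qAX − q⁻¹XA)/(q − q⁻¹) = aX² + a⁻¹`,
`a⁻¹x² − ((a⁻¹q − aq⁻¹)/(q − q⁻¹))xX − ((aq − a⁻¹q⁻¹)/(q − q⁻¹))Xx + aX² = 0`;
here `U_q^∨` is taken in its presentation by generators `x, y⁻¹, z` (the algebra `Ū_q`).
The isomorphism sends `x ↦ x`, `X ↦ a⁻²x + (1 − a⁻²)y⁻¹`, `A ↦ a⁻¹x + az`; its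
inverse sends `x ↦ x`, `y⁻¹ ↦ (aX − a⁻¹x)/(a − a⁻¹)`, `z ↦ a⁻¹A − a⁻²x`. -/
theorem statement4 (F : Type*) [Field F] (q : F) (hq0 : q ≠ 0) (hq4 : q ^ 4 ≠ 1)
    (a : F) (ha0 : a ≠ 0) (ha2 : a ^ 2 ≠ 1) :
    ∃ e : UP F q a ≃ₐ[F] Ubar F q,
      e (px F q a) = bx F q ∧
      e (pX F q a) = (a ^ 2)⁻¹ • bx F q + (1 - (a ^ 2)⁻¹) • bybar F q ∧
      e (pA F q a) = a⁻¹ • bx F q + a • bz F q ∧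
      e.symm (bx F q) = px F q a ∧
      e.symm (bybar F q) = (a - a⁻¹)⁻¹ • (a • pX F q a - a⁻¹ • px F q a) ∧
      e.symm (bz F q) = a⁻¹ • pA F q a - (a ^ 2)⁻¹ • px F q a := by
  have hq2 : q ^ 2 - 1 ≠ 0 := fun h => hq4 (by linear_combination (q ^ 2 + 1) * h)
  have ha2' : a ^ 2 - 1 ≠ 0 := sub_ne_zero.mpr ha2
  have haa : a - a⁻¹ = (a ^ 2 - 1) / a := by field_simp
  let f : UP F q a →ₐ[F] Ubar F q := RingQuot.liftAlgHom F
    ⟨FreeAlgebra.lift F (fwdGen F q a), fun _ _ h => fwd_rel F q hq0 hq2 a ha0 h⟩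
  let g : Ubar F q →ₐ[F] UP F q a := RingQuot.liftAlgHom F
    ⟨FreeAlgebra.lift F (bwdGen F q a), fun _ _ h => bwd_rel F q hq0 hq2 a ha0 ha2' h⟩
  have fx : f (px F q a) = bx F q := by simp [f, px, fwdGen]
  have fX : f (pX F q a) = (a ^ 2)⁻¹ • bx F q + (1 - (a ^ 2)⁻¹) • bybar F q := by
    simp only [f, pX, RingQuot.liftAlgHom_mkAlgHom_apply, FreeAlgebra.lift_ι_apply, fwdGen]
  have fA : f (pA F q a) = a⁻¹ • bx F q + a • bz F q := by simp [f, pA, fwdGen]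
  have gx : g (bx F q) = px F q a := by simp [g, bx, bwdGen]
  have gy : g (bybar F q) = (a - a⁻¹)⁻¹ • (a • pX F q a - a⁻¹ • px F q a) := by
    simp only [g, bybar, RingQuot.liftAlgHom_mkAlgHom_apply, FreeAlgebra.lift_ι_apply, bwdGen]
  have gz : g (bz F q) = a⁻¹ • pA F q a - (a ^ 2)⁻¹ • px F q a := by
    simp only [g, bz, RingQuot.liftAlgHom_mkAlgHom_apply, FreeAlgebra.lift_ι_apply, bwdGen]
  have hfg : f.comp g = AlgHom.id F _ := by
    apply RingQuot.ringQuot_ext'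
    apply FreeAlgebra.hom_ext
    funext i
    cases i
    · change f (g (bx F q)) = bx F q
      rw [gx, fx]
    · change f (g (bybar F q)) = bybar F q
      rw [gy, map_smul, map_sub, map_smul, map_smul, fx, fX, haa]
      match_scalars <;> field_simp <;> ring
    · change f (g (bz F q)) = bz F q
      rw [gz, map_sub, map_smul, map_smul, fx, fA]
      match_scalars <;> field_simp <;> ring
  have hgf : g.comp f = AlgHom.id F _ := by
    apply RingQuot.ringQuot_ext'
    apply FreeAlgebra.hom_ext
    funext i
    cases i
    · change g (f (px F q a)) = px F q a
      rw [fx, gx]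
    · change g (f (pX F q a)) = pX F q a
      rw [fX, map_add, map_smul, map_smul, gx, gy, haa]
      match_scalars <;> field_simp <;> ring
    · change g (f (pA F q a)) = pA F q a
      rw [fA, map_add, map_smul, map_smul, gx, gz]
      match_scalars <;> field_simp <;> ring
  exact ⟨AlgEquiv.ofAlgHom f g hfg hgf, fx, fX, fA, gx, gy, gz⟩

end Paper
end

section
/- The element y⁻¹ is not invertible in the algebra U_q^∨; that is, there is no ξ ∈ U_q^∨ with ξ y⁻¹ = 1 = y⁻¹ ξ. -/
namespace Paper


/-- Multiplication by `T` on (formal) Laurent series, as functions `ℤ → F`. -/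
def shiftUp (F : Type*) [Field F] (k : ℤ) : Module.End F (ℤ → F) where
  toFun f := fun n => f (n - k)
  map_add' f g := by ext n; simp
  map_smul' c f := by ext n; simp

def opX (F : Type*) [Field F] (q : F) : Module.End F (ℤ → F) where
  toFun f := fun n => f (n - 1) + q ^ (2 * n) * f n
  map_add' f g := by ext n; simp; ring
  map_smul' c f := by ext n; simp; ring

def opZ (F : Type*) [Field F] (q : F) : Module.End F (ℤ → F) where
  toFun f := fun n => f (n - 1) + q ^ (-2 * n) * f n + q ^ (2 - 2 * n) * f (n - 2)
  map_add' f g := by ext n; simp; ring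
  map_smul' c f := by ext n; simp; ring

def genMap (F : Type*) [Field F] (q : F) : EqGen → Module.End F (ℤ → F)
  | EqGen.x => opX F q
  | EqGen.y => shiftUp F (-1)
  | EqGen.y' => shiftUp F 1
  | EqGen.z => opZ F q

lemma genMap_rel (F : Type*) [Field F] (q : F) (hq0 : q ≠ 0)
    ⦃a b : FreeAlgebra F EqGen⦄ (h : EqRel F q a b) :
    FreeAlgebra.lift F (genMap F q) a = FreeAlgebra.lift F (genMap F q) b := by
  cases h
  all_goals
    simp only [map_mul, map_sub, map_smul, map_one, FreeAlgebra.lift_ι_apply, genMap]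
    refine LinearMap.ext fun f => funext fun n => ?_
    simp only [shiftUp, opX, opZ, Module.End.mul_apply, LinearMap.coe_mk, AddHom.coe_mk,
      LinearMap.sub_apply, LinearMap.smul_apply, Pi.sub_apply, Pi.smul_apply, smul_eq_mul,
      Module.End.one_apply]
  · ring_nf
  · ring_nf
  · have e1 : n - -1 - 1 = n := by ring
    have e2 : n - 1 - -1 = n := by ring
    have e3 : q ^ (2 * (n - -1)) = q ^ (2 * n) * q ^ 2 := by
      rw [show 2 * (n - -1) = 2 * n + 2 by ring, zpow_add₀ hq0]; norm_cast
    rw [e1, e2, e3]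
    field_simp
    ring
  · have e1 : n - -1 - 1 = n := by ring
    have e2 : n - 1 - -1 = n := by ring
    have e3 : q ^ (-2 * (n - -1)) = q ^ (-2 * n) * (q ^ 2)⁻¹ := by
      rw [show -2 * (n - -1) = -2 * n - 2 by ring, zpow_sub₀ hq0, div_eq_mul_inv]; norm_cast
    have e4 : q ^ (2 - 2 * n) = q ^ 2 * q ^ (-2 * n) := by
      rw [show 2 - 2 * n = 2 + -2 * n by ring, zpow_add₀ hq0]; norm_cast
    have e5 : q ^ (2 - 2 * (n - -1)) = q ^ (-2 * n) := by
      congr 1; ring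
    have e6 : n - -1 - 2 = n - 1 := by ring
    have e7 : n - 2 - -1 = n - 1 := by ring
    rw [e1, e2, e3, e4, e5, e6, e7]
    field_simp
    ring
  · have e1 : n - 1 - 1 = n - 2 := by ring
    have e2 : n - 2 - 1 = n - 3 := by ring
    have e3 : n - 1 - 2 = n - 3 := by ring
    have e4 : q ^ (-2 * n) = (q ^ (2 * n))⁻¹ := by
      rw [← zpow_neg]; congr 1; ring
    have e5 : q ^ (2 - 2 * n) = q ^ 2 * (q ^ (2 * n))⁻¹ := by
      rw [zpow_sub₀ hq0, div_eq_mul_inv]; norm_cast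
    have e6 : q ^ (2 * (n - 1)) = q ^ (2 * n) * (q ^ 2)⁻¹ := by
      rw [show 2 * (n - 1) = 2 * n - 2 by ring, zpow_sub₀ hq0, div_eq_mul_inv]; norm_cast
    have e7 : q ^ (2 * (n - 2)) = q ^ (2 * n) * (q ^ 4)⁻¹ := by
      rw [show 2 * (n - 2) = 2 * n - 4 by ring, zpow_sub₀ hq0, div_eq_mul_inv]; norm_cast
    have e8 : q ^ (-2 * (n - 1)) = (q ^ (2 * n))⁻¹ * q ^ 2 := by
      rw [show -2 * (n - 1) = -(2 * n) + 2 by ring, zpow_add₀ hq0, zpow_neg]; norm_cast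
    have e9 : q ^ (2 - 2 * (n - 1)) = q ^ 4 * (q ^ (2 * n))⁻¹ := by
      rw [show 2 - 2 * (n - 1) = 4 - 2 * n by ring, zpow_sub₀ hq0, div_eq_mul_inv]; norm_cast
    rw [e1, e2, e3, e4, e5, e6, e7, e8, e9]
    have hP : q ^ (2 * n) ≠ 0 := zpow_ne_zero _ hq0
    generalize q ^ (2 * n) = P at hP
    field_simp
    ring

noncomputable def rep (F : Type*) [Field F] (q : F) (hq0 : q ≠ 0) :
    Usl2 F q →ₐ[F] Module.End F (ℤ → F) :=
  RingQuot.liftAlgHom F ⟨FreeAlgebra.lift F (genMap F q), genMap_rel F q hq0⟩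

lemma rep_gen (F : Type*) [Field F] (q : F) (hq0 : q ≠ 0) (g : EqGen) :
    rep F q hq0 (RingQuot.mkAlgHom F (EqRel F q) (FreeAlgebra.ι F g)) = genMap F q g := by
  simp [rep]

lemma rep_preserves (F : Type*) [Field F] (q : F) (hq0 : q ≠ 0) (ξ : Usl2 F q)
    (hξ : ξ ∈ Uvee F q) :
    ∀ f : ℤ → F, (∀ n < 0, f n = 0) → ∀ n < 0, rep F q hq0 ξ f n = 0 := by
  unfold Uvee at hξ
  induction hξ using Algebra.adjoin_induction with
  | mem a ha =>
    intro f hf n hn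
    have h1 := hf (n - 1) (by omega)
    have h2 := hf (n - 2) (by omega)
    have h3 := hf n hn
    rcases ha with rfl | rfl | rfl
    · rw [ux, rep_gen]; simp [genMap, opX, h1, h3]
    · rw [uy', rep_gen]; simp [genMap, shiftUp, h1]
    · rw [uz, rep_gen]; simp [genMap, opZ, h1, h2, h3]
  | algebraMap r =>
    intro f hf n hn
    simp [Module.algebraMap_end_apply, hf n hn]
  | add a b _ _ iha ihb =>
    intro f hf n hn
    simp [iha f hf n hn, ihb f hf n hn]
  | mul a b _ _ iha ihb =>
    intro f hf n hn
    rw [map_mul, Module.End.mul_apply]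
    exact iha _ (ihb f hf) n hn

/-- **Lemma 10.13.** The element `y⁻¹` is not invertible in the algebra `U_q^∨`:
there is no `ξ ∈ U_q^∨` with `ξ y⁻¹ = 1 = y⁻¹ ξ`. -/
theorem statement9 (F : Type*) [Field F] (q : F) (hq0 : q ≠ 0) (hq4 : q ^ 4 ≠ 1) :
    ¬ ∃ ξ : Usl2 F q, ξ ∈ Uvee F q ∧ ξ * uy' F q = 1 ∧ uy' F q * ξ = 1 := by
  rintro ⟨ξ, hξ, -, h⟩
  have hp := rep_preserves F q hq0 ξ hξ (Pi.single 0 1)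
    (fun n hn => by simp [Pi.single_apply, hn.ne]) (-1) (by norm_num)
  have h2 := congrArg (fun a => rep F q hq0 a (Pi.single 0 1) 0) h
  simp only [map_mul, map_one, Module.End.mul_apply, Module.End.one_apply] at h2
  rw [uy', rep_gen] at h2
  simp only [genMap, shiftUp, LinearMap.coe_mk, AddHom.coe_mk, zero_sub, Pi.single_eq_same] at h2
  rw [hp] at h2
  exact zero_ne_one h2

end Paper
end
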